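/- Let Assumption B(i) hold and let {α_n} ⊂ [0,1) with α_n ↑ 1 be a fixed sequence. Suppose there exist a measurable function u : X → [0,+∞) and a deterministic policy φ such that c(x,φ(x)) + ∫_X u(y) q(dy|x,φ(x)) ≤ w̄_{{α_n}} + u(x) for all x ∈ X. Then φ is average-cost optimal; for every x ∈ X, w(x) = w^φ(x) = limsup_{n→∞} (1−α_n) v_{α_n}(x) = limsup_{α↑1} (1−α) v_α(x) = w̄ = w̄_{{α_n}} = w*; and φ together with the same function u satisfies the WACOI. -/

import Mathlib

open MeasureTheory ProbabilityTheory Filter Topology Set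
open scoped ENNReal NNReal

noncomputable section

/-- The nonnegative part of an extended real, as an element of `ℝ≥0∞`. -/
def eToENN (x : EReal) : ℝ≥0∞ := if x = ⊤ then ⊤ else ENNReal.ofReal x.toReal

/-- Extended integral of an `EReal`-valued function: positive part minus negative part. -/
def eInt {Y : Type*} [MeasurableSpace Y] (μ : Measure Y) (f : Y → EReal) : EReal :=
  ((∫⁻ y, eToENN (f y) ∂μ : ℝ≥0∞) : EReal) - ((∫⁻ y, eToENN (-(f y)) ∂μ : ℝ≥0∞) : EReal)

/-- Extended sum of an `EReal`-valued series: positive part minus negative part. -/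
def eSum (f : ℕ → EReal) : EReal :=
  ((∑' t, eToENN (f t) : ℝ≥0∞) : EReal) - ((∑' t, eToENN (-(f t)) : ℝ≥0∞) : EReal)

/-- Histories of length `t`: `(X × A) ^ t × X`. -/
abbrev Hist (X A : Type*) (t : ℕ) := (Fin t → X × A) × X

/-- A (randomized, history-dependent) policy: a regular transition probability from
histories to actions, at every time epoch. -/
structure Policy (X A : Type*) [MeasurableSpace X] [MeasurableSpace A] where
  π : ∀ t : ℕ, Kernel (Hist X A t) A
  markov : ∀ t, IsMarkovKernel (π t)

/-- A Markov decision process with state space `X`, action space `A`, one-step cost `c`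
(measurable and bounded below, with values in `(-∞, +∞]`) and transition probability `q`. -/
structure MDP (X A : Type*) [MeasurableSpace X] [MeasurableSpace A] where
  c : X → A → EReal
  q : Kernel (X × A) X
  markov : IsMarkovKernel q
  c_meas : Measurable fun p : X × A => c p.1 p.2
  c_ne_bot : ∃ K : ℝ, ∀ x a, (K : EReal) ≤ c x a

variable {X A : Type*} [MeasurableSpace X] [MeasurableSpace A]

/-- The deterministic policy given by a measurable map `φ : X → A` applied to the current state. -/
def detPolicy (φ : X → A) (hφ : Measurable φ) : Policy X A :=
  ⟨fun t => Kernel.deterministic (fun h : Hist X A t => φ h.2) (hφ.comp measurable_snd),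
   fun _ => by infer_instance⟩

/-- The distribution `P_x^π` of the history `h_t`, constructed recursively
(Ionescu-Tulcea finite-dimensional marginals). -/
def histMeas (M : MDP X A) (p : Policy X A) (x : X) : ∀ t : ℕ, Measure (Hist X A t)
  | 0 => Measure.dirac (Fin.elim0, x)
  | (t + 1) =>
      (histMeas M p x t).bind fun h =>
        ((p.π t) h).bind fun a =>
          (M.q (h.2, a)).map fun x' => (Fin.snoc h.1 (h.2, a), x')

/-- The joint distribution of the state-action pair `(x_t, a_t)` under `P_x^π`. -/
def saMeas (M : MDP X A) (p : Policy X A) (x : X) (t : ℕ) : Measure (X × A) :=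
  (histMeas M p x t).bind fun h => ((p.π t) h).map fun a => (h.2, a)

/-- `E_x^π c(x_t, a_t)`. -/
def expCost (M : MDP X A) (p : Policy X A) (x : X) (t : ℕ) : EReal :=
  eInt (saMeas M p x t) fun sa => M.c sa.1 sa.2

/-- The expected total discounted cost `v_α^π(x) = E_x^π ∑_t α^t c(x_t, a_t)`. -/
def vDisc (M : MDP X A) (α : ℝ) (p : Policy X A) (x : X) : EReal :=
  eSum fun t => ((α ^ t : ℝ) : EReal) * expCost M p x t

/-- The finite-horizon expected total (undiscounted) cost `v_{N,1}^π(x)`. -/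
def vFin (M : MDP X A) (N : ℕ) (p : Policy X A) (x : X) : EReal :=
  ∑ t ∈ Finset.range N, expCost M p x t

/-- The discounted value function `v_α(x) = inf_π v_α^π(x)`. -/
def vDiscOpt (M : MDP X A) (α : ℝ) (x : X) : EReal :=
  ⨅ p : Policy X A, vDisc M α p x

/-- The average cost per unit time `w^π(x)`. -/
def avgCost (M : MDP X A) (p : Policy X A) (x : X) : EReal :=
  Filter.limsup (fun N : ℕ => (((N : ℝ)⁻¹ : ℝ) : EReal) * vFin M N p x) atTop

/-- The optimal average cost `w(x) = inf_π w^π(x)`. -/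
def avgOpt (M : MDP X A) (x : X) : EReal :=
  ⨅ p : Policy X A, avgCost M p x

/-- `w* = inf_x w(x)`. -/
def wStar (M : MDP X A) : EReal := ⨅ x : X, avgOpt M x

/-- `m_α = inf_x v_α(x)`. -/
def mDisc (M : MDP X A) (α : ℝ) : EReal := ⨅ x : X, vDiscOpt M α x

/-- The discounted relative value function `u_α(x) = v_α(x) - m_α`. -/
def uDisc (M : MDP X A) (α : ℝ) (x : X) : EReal := vDiscOpt M α x - mDisc M α

/-- `w̄ = limsup_{α↑1} (1-α) m_α`. -/
def wBar (M : MDP X A) : EReal :=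
  Filter.limsup (fun α : ℝ => ((1 - α : ℝ) : EReal) * mDisc M α) (𝓝[Set.Ico (0:ℝ) 1] 1)

/-- `w̲ = liminf_{α↑1} (1-α) m_α`. -/
def wLow (M : MDP X A) : EReal :=
  Filter.liminf (fun α : ℝ => ((1 - α : ℝ) : EReal) * mDisc M α) (𝓝[Set.Ico (0:ℝ) 1] 1)

/-- `w̄_{{α_n}} = limsup_n (1-α_n) m_{α_n}`. -/
def wBarSeq (M : MDP X A) (a : ℕ → ℝ) : EReal :=
  Filter.limsup (fun n : ℕ => ((1 - a n : ℝ) : EReal) * mDisc M (a n)) atTop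

/-- `w̲_{{α_n}} = liminf_n (1-α_n) m_{α_n}`. -/
def wLowSeq (M : MDP X A) (a : ℕ → ℝ) : EReal :=
  Filter.liminf (fun n : ℕ => ((1 - a n : ℝ) : EReal) * mDisc M (a n)) atTop


section TopologicalAssumptions

variable {X A : Type*} [MetricSpace X] [TopologicalSpace.SeparableSpace X]
  [MeasurableSpace X] [BorelSpace X] [StandardBorelSpace X]
  [MetricSpace A] [TopologicalSpace.SeparableSpace A]
  [MeasurableSpace A] [BorelSpace A] [StandardBorelSpace A]

/-- Assumption W*(i): the cost `c` is `K`-inf-compact, i.e., for every nonempty compact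
`K ⊆ X`, the restriction of `c` to `K × A` has compact sublevel sets. -/
def AssumptionWi (M : MDP X A) : Prop :=
  ∀ K : Set X, K.Nonempty → IsCompact K →
    ∀ lam : ℝ, IsCompact {p : X × A | p.1 ∈ K ∧ M.c p.1 p.2 ≤ (lam : EReal)}

/-- Assumption W*(ii): the transition probability `q(·|x,a)` is weakly continuous in `(x,a)`. -/
def AssumptionWii (M : MDP X A) : Prop :=
  ∀ f : BoundedContinuousFunction X ℝ, Continuous fun p : X × A => ∫ y, f y ∂ (M.q p)

/-- Assumption S*(i): for each `x`, the function `a ↦ c(x,a)` has compact sublevel sets. -/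
def AssumptionSi (M : MDP X A) : Prop :=
  ∀ x : X, ∀ lam : ℝ, IsCompact {a : A | M.c x a ≤ (lam : EReal)}

/-- Assumption S*(ii): for each `x`, the transition probability `q(·|x,a)` is setwise
continuous in `a`. -/
def AssumptionSii (M : MDP X A) : Prop :=
  ∀ x : X, ∀ B : Set X, MeasurableSet B → Continuous fun a : A => M.q (x, a) B

end TopologicalAssumptions

section ExtendedIntegral

lemma eToENN_coe_sub_add (g : ℝ≥0∞) (b : ℝ≥0) :
    eToENN ((g : EReal) - (b : ℝ)) + b = g + eToENN (-((g : EReal) - (b : ℝ))) := by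
  induction g with
  | top => simp [eToENN]
  | coe g =>
    have h1 : ((g : ℝ≥0∞) : EReal) - (b : ℝ) = (((g : ℝ) - b : ℝ) : EReal) := by
      rw [EReal.coe_sub]; rfl
    rw [h1, ← EReal.coe_neg]
    simp only [eToENN, EReal.coe_ne_top, if_false, EReal.toReal_coe]
    rw [← ENNReal.ofReal_coe_nnreal (p := b), ← ENNReal.ofReal_coe_nnreal (p := g)]
    rcases le_total (g : ℝ) b with h | h
    · rw [ENNReal.ofReal_of_nonpos (by linarith), ← ENNReal.ofReal_add (by simp) (by linarith)]
      simp
    · rw [ENNReal.ofReal_of_nonpos (p := -((g : ℝ) - b)) (by linarith),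
        ← ENNReal.ofReal_add (by linarith) (by simp)]
      simp

lemma eToENN_neg_coe_sub_le (g : ℝ≥0∞) (b : ℝ≥0) :
    eToENN (-((g : EReal) - (b : ℝ))) ≤ b := by
  induction g with
  | top => simp [eToENN]
  | coe g =>
    have h1 : ((g : ℝ≥0∞) : EReal) - (b : ℝ) = (((g : ℝ) - b : ℝ) : EReal) := by
      rw [EReal.coe_sub]; rfl
    rw [h1, ← EReal.coe_neg]
    simp only [eToENN, EReal.coe_ne_top, if_false, EReal.toReal_coe]
    rw [← ENNReal.ofReal_coe_nnreal (p := b)]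
    exact ENNReal.ofReal_le_ofReal (by have := g.2; simp)

lemma coe_sub_coe_eq_of_add_eq_add {p n g b : ℝ≥0∞} (h : p + b = g + n) (hn : n ≠ ⊤)
    (hb : b ≠ ⊤) : (p : EReal) - n = (g : EReal) - b := by
  lift n to ℝ≥0 using hn
  lift b to ℝ≥0 using hb
  induction p with
  | top =>
    induction g with
    | top => rfl
    | coe g => simp [← ENNReal.coe_add] at h
  | coe p =>
    induction g with
    | top => simp [← ENNReal.coe_add] at h
    | coe g =>
      have h' : (p : ℝ) + b = g + n := by exact_mod_cast h
      change (((p : ℝ) : EReal)) - ((n : ℝ) : EReal) = ((g : ℝ) : EReal) - ((b : ℝ) : EReal)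
      rw [← EReal.coe_sub, ← EReal.coe_sub]
      congr 1
      linarith

lemma eInt_coe_sub {Y : Type*} [MeasurableSpace Y] (μ : Measure Y) {g : Y → ℝ≥0∞} {b : Y → ℝ≥0}
    (hg : Measurable g) (hb : Measurable b) (hbt : ∫⁻ y, b y ∂μ ≠ ⊤) :
    eInt μ (fun y => (g y : EReal) - (b y : ℝ))
      = ((∫⁻ y, g y ∂μ : ℝ≥0∞) : EReal) - ((∫⁻ y, b y ∂μ : ℝ≥0∞) : EReal) := by
  refine coe_sub_coe_eq_of_add_eq_add ?_ ?_ hbt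
  · rw [← lintegral_add_right _ hb.coe_nnreal_ennreal, ← lintegral_add_left hg]
    exact lintegral_congr fun y => eToENN_coe_sub_add _ _
  · exact ne_top_of_le_ne_top hbt (lintegral_mono fun y => eToENN_neg_coe_sub_le _ _)

lemma eSum_coe_sub {g : ℕ → ℝ≥0∞} {b : ℕ → ℝ≥0} (hbt : ∑' t, (b t : ℝ≥0∞) ≠ ⊤) :
    eSum (fun t => (g t : EReal) - (b t : ℝ))
      = ((∑' t, g t : ℝ≥0∞) : EReal) - ((∑' t, (b t : ℝ≥0∞) : ℝ≥0∞) : EReal) := by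
  have h := eInt_coe_sub Measure.count (measurable_of_countable g) (measurable_of_countable b)
    (by rwa [lintegral_count])
  simp only [eInt, lintegral_count] at h
  exact h

end ExtendedIntegral

section Histories

lemma measurable_map_kernel {α β γ : Type*} [MeasurableSpace α] [MeasurableSpace β]
    [MeasurableSpace γ] (κ : Kernel α β) [IsSFiniteKernel κ] {F : α × β → γ}
    (hF : Measurable F) : Measurable fun a => (κ a).map fun b => F (a, b) := by
  refine Measure.measurable_of_measurable_coe _ fun s hs => ?_
  have h : ∀ a, (κ a).map (fun b => F (a, b)) s = κ a (Prod.mk a ⁻¹' (F ⁻¹' s)) := fun a =>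
    Measure.map_apply (hF.comp measurable_prodMk_left) hs
  simp_rw [h]
  exact Kernel.measurable_kernel_prodMk_left (hF hs)

lemma measurable_bind_kernel {α β γ : Type*} [MeasurableSpace α] [MeasurableSpace β]
    [MeasurableSpace γ] (κ : Kernel α β) [IsSFiniteKernel κ] {F : α × β → Measure γ}
    (hF : Measurable F) : Measurable fun a => (κ a).bind fun b => F (a, b) := by
  refine Measure.measurable_of_measurable_coe _ fun s hs => ?_
  have h : ∀ a, (κ a).bind (fun b => F (a, b)) s = ∫⁻ b, F (a, b) s ∂κ a := fun a =>
    Measure.bind_apply hs (hF.comp measurable_prodMk_left).aemeasurable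
  simp_rw [h]
  exact Measurable.lintegral_kernel_prod_right ((Measure.measurable_coe hs).comp hF)

lemma measurable_hist_snoc (t : ℕ) : Measurable
    fun hax : (Hist X A t × A) × X =>
      ((Fin.snoc hax.1.1.1 (hax.1.1.2, hax.1.2), hax.2) : Hist X A (t + 1)) := by
  refine Measurable.prodMk (measurable_pi_lambda _ fun i => ?_) measurable_snd
  induction i using Fin.lastCases with
  | last => simp only [Fin.snoc_last]; fun_prop
  | cast i => simp only [Fin.snoc_castSucc]; fun_prop

variable (M : MDP X A) (p : Policy X A)

lemma measurable_map_transition (t : ℕ) : Measurable fun ha : Hist X A t × A =>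
    (M.q (ha.1.2, ha.2)).map
      fun x' => ((Fin.snoc ha.1.1 (ha.1.2, ha.2), x') : Hist X A (t + 1)) := by
  have := M.markov
  have hp : Measurable fun ha : Hist X A t × A => (ha.1.2, ha.2) := by fun_prop
  have h := measurable_map_kernel (M.q.comap _ hp) (measurable_hist_snoc t)
  simp only [Kernel.comap_apply] at h
  exact h

lemma measurable_bind_transition (t : ℕ) : Measurable fun h : Hist X A t =>
    ((p.π t) h).bind fun a =>
      (M.q (h.2, a)).map fun x' => ((Fin.snoc h.1 (h.2, a), x') : Hist X A (t + 1)) := by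
  have := p.markov t
  have h := measurable_bind_kernel (p.π t) (measurable_map_transition M t)
  exact h

lemma measurable_map_stateAction (t : ℕ) :
    Measurable fun h : Hist X A t => ((p.π t) h).map fun a => (h.2, a) := by
  have := p.markov t
  exact measurable_map_kernel (p.π t) (F := fun ha => (ha.1.2, ha.2)) (by fun_prop)

lemma lintegral_histMeas_succ (x : X) (t : ℕ) {f : X → ℝ≥0∞} (hf : Measurable f) :
    ∫⁻ h, f h.2 ∂histMeas M p x (t + 1)
      = ∫⁻ h, ∫⁻ a, ∫⁻ y, f y ∂M.q (h.2, a) ∂p.π t h ∂histMeas M p x t := by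
  have hf' : Measurable fun h : Hist X A (t + 1) => f h.2 := hf.comp measurable_snd
  rw [histMeas, Measure.lintegral_bind (measurable_bind_transition M p t).aemeasurable
    hf'.aemeasurable]
  refine lintegral_congr fun h => ?_
  have hm : Measurable fun a => (M.q (h.2, a)).map
      fun x' => ((Fin.snoc h.1 (h.2, a), x') : Hist X A (t + 1)) :=
    (measurable_map_transition M t).comp (measurable_prodMk_left (x := h))
  rw [Measure.lintegral_bind hm.aemeasurable hf'.aemeasurable]
  refine lintegral_congr fun a => ?_
  exact lintegral_map hf'
    ((measurable_hist_snoc t).comp (measurable_prodMk_left (x := (h, a))))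

lemma lintegral_saMeas (x : X) (t : ℕ) {f : X × A → ℝ≥0∞} (hf : Measurable f) :
    ∫⁻ sa, f sa ∂saMeas M p x t
      = ∫⁻ h, ∫⁻ a, f (h.2, a) ∂p.π t h ∂histMeas M p x t := by
  rw [saMeas, Measure.lintegral_bind (measurable_map_stateAction p t).aemeasurable
    hf.aemeasurable]
  exact lintegral_congr fun h => lintegral_map hf measurable_prodMk_left

lemma lintegral_one_histMeas (x : X) (t : ℕ) : ∫⁻ _, 1 ∂histMeas M p x t = 1 := by
  have := M.markov
  induction t with
  | zero => simp [histMeas]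
  | succ t ih =>
    have := p.markov t
    rw [lintegral_histMeas_succ M p x t (f := fun _ => 1) measurable_const]
    simpa using ih

lemma lintegral_const_saMeas (x : X) (t : ℕ) (b : ℝ≥0∞) : ∫⁻ _, b ∂saMeas M p x t = b := by
  have := p.markov t
  have h := lintegral_one_histMeas M p x t
  rw [lintegral_saMeas M p x t (f := fun _ => b) measurable_const]
  simp only [lintegral_const, measure_univ, mul_one, one_mul] at h ⊢
  rw [h, mul_one]

end Histories

section ShiftedCost

/-- The one-step cost shifted by a constant, as a nonnegative extended real. -/
def shiftCost (M : MDP X A) (L : ℝ≥0) (sa : X × A) : ℝ≥0∞ :=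
  (M.c sa.1 sa.2 + (L : ℝ)).toENNReal

/-- The expected shifted cost at time `t`. -/
def expShiftCost (M : MDP X A) (L : ℝ≥0) (p : Policy X A) (x : X) (t : ℕ) : ℝ≥0∞ :=
  ∫⁻ sa, shiftCost M L sa ∂saMeas M p x t

lemma measurable_shiftCost (M : MDP X A) (L : ℝ≥0) : Measurable (shiftCost M L) :=
  EReal.continuous_toENNReal.measurable.comp (M.c_meas.add_const _)

lemma coe_shiftCost {M : MDP X A} {L : ℝ≥0} (hL : ∀ x a, ((-L : ℝ) : EReal) ≤ M.c x a)
    (x : X) (a : A) : (shiftCost M L (x, a) : EReal) = M.c x a + (L : ℝ) := by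
  refine EReal.coe_toENNReal ?_
  have h := add_le_add_left (hL x a) ((L : ℝ) : EReal)
  rwa [← EReal.coe_add, neg_add_cancel] at h

lemma expCost_eq {M : MDP X A} {L : ℝ≥0} (hL : ∀ x a, ((-L : ℝ) : EReal) ≤ M.c x a)
    (p : Policy X A) (x : X) (t : ℕ) :
    expCost M p x t = (expShiftCost M L p x t : EReal) - (L : ℝ) := by
  have h : (fun sa : X × A => M.c sa.1 sa.2)
      = fun sa => (shiftCost M L sa : EReal) - (L : ℝ) := by
    funext sa
    rw [coe_shiftCost hL sa.1 sa.2, EReal.add_sub_cancel_right]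
  have hc := lintegral_const_saMeas M p x t (L : ℝ≥0∞)
  rw [expCost, h, eInt_coe_sub _ (measurable_shiftCost M L) measurable_const (by simp [hc]), hc]
  rfl

lemma vFin_eq {M : MDP X A} {L : ℝ≥0} (hL : ∀ x a, ((-L : ℝ) : EReal) ≤ M.c x a)
    (p : Policy X A) (x : X) (N : ℕ) :
    vFin M N p x
      = ((∑ t ∈ Finset.range N, expShiftCost M L p x t : ℝ≥0∞) : EReal) - ((N * L : ℝ) : EReal) := by
  induction N with
  | zero => simp [vFin]
  | succ N ih =>
    rw [vFin, Finset.sum_range_succ] at *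
    rw [ih, expCost_eq hL, Finset.sum_range_succ, EReal.coe_ennreal_add]
    generalize ((∑ t ∈ Finset.range N, expShiftCost M L p x t : ℝ≥0∞) : EReal) = s
    generalize ((expShiftCost M L p x N : ℝ≥0∞) : EReal) = r
    rw [show (((N + 1 : ℕ) : ℝ) * L : ℝ) = N * L + L by push_cast; ring, EReal.coe_add,
      sub_eq_add_neg, sub_eq_add_neg, sub_eq_add_neg, EReal.neg_add (by simp) (by simp),
      sub_eq_add_neg]
    exact add_add_add_comm _ _ _ _

lemma vDisc_eq {M : MDP X A} {L : ℝ≥0} (hL : ∀ x a, ((-L : ℝ) : EReal) ≤ M.c x a)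
    (p : Policy X A) (x : X) {α : ℝ≥0} (hα : α < 1) :
    vDisc M α p x = ((∑' t, (α : ℝ≥0∞) ^ t * expShiftCost M L p x t : ℝ≥0∞) : EReal)
      - ((L / (1 - α) : ℝ) : EReal) := by
  have hs : HasSum (fun t : ℕ => α ^ t * L) ((1 - α)⁻¹ * L) :=
    (NNReal.hasSum_geometric hα).mul_right L
  have hs' : ∑' t : ℕ, ((α ^ t * L : ℝ≥0) : ℝ≥0∞) = (((1 - α)⁻¹ * L : ℝ≥0) : ℝ≥0∞) :=
    (ENNReal.hasSum_coe.2 hs).tsum_eq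
  have h : ∀ t, (((α : ℝ) ^ t : ℝ) : EReal) * expCost M p x t
      = (((α : ℝ≥0∞) ^ t * expShiftCost M L p x t : ℝ≥0∞) : EReal)
        - ((α ^ t * L : ℝ≥0) : ℝ) := by
    intro t
    have hc : ((((α : ℝ≥0∞) ^ t : ℝ≥0∞)) : EReal) = (((α : ℝ) ^ t : ℝ) : EReal) := by
      rw [← ENNReal.coe_pow, ← NNReal.coe_pow]; rfl
    rw [expCost_eq hL, EReal.coe_ennreal_mul, hc, sub_eq_add_neg, ← EReal.coe_neg,
      EReal.left_distrib_of_nonneg_of_ne_top (by positivity) (EReal.coe_ne_top _), ← EReal.coe_mul,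
      mul_neg, EReal.coe_neg, ← sub_eq_add_neg]
    push_cast
    rfl
  rw [vDisc, funext h, eSum_coe_sub (by rw [hs']; exact ENNReal.coe_ne_top), hs']
  congr 1
  have : ((((1 - α)⁻¹ * L : ℝ≥0) : ℝ)) = L / (1 - α) := by
    rw [NNReal.coe_mul, NNReal.coe_inv, NNReal.coe_sub hα.le, NNReal.coe_one, div_eq_inv_mul]
  rw [← this]
  rfl

end ShiftedCost

section Abel

lemma tsum_pow_mul_eq (α : ℝ≥0) (hα : α < 1) (C : ℕ → ℝ≥0∞) :
    ∑' t, (α : ℝ≥0∞) ^ t * C t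
      = (1 - (α : ℝ≥0∞)) * ∑' N, (α : ℝ≥0∞) ^ N * ∑ t ∈ Finset.range (N + 1), C t := by
  have h1 : (1 - (α : ℝ≥0∞)) ≠ 0 := (tsub_pos_of_lt (by exact_mod_cast hα)).ne'
  have h2 : (1 - (α : ℝ≥0∞)) ≠ ⊤ := by finiteness
  have h3 : ∀ N, (α : ℝ≥0∞) ^ N * ∑ t ∈ Finset.range (N + 1), C t
      = ∑' t, if t ≤ N then (α : ℝ≥0∞) ^ N * C t else 0 := fun N => by
    rw [tsum_eq_sum (s := Finset.range (N + 1)) (fun t ht => if_neg (by simpa using ht)),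
      Finset.mul_sum]
    exact Finset.sum_congr rfl fun t ht => (if_pos (by simpa [Nat.lt_succ_iff] using ht)).symm
  simp_rw [h3]
  rw [ENNReal.tsum_comm, ← ENNReal.tsum_mul_left]
  refine tsum_congr fun t => ?_
  have h4 : ∑' N, (if t ≤ N then (α : ℝ≥0∞) ^ N * C t else 0)
      = ∑' N, (α : ℝ≥0∞) ^ (N + t) * C t := by
    rw [← ENNReal.summable.sum_add_tsum_nat_add' (k := t), Finset.sum_eq_zero, zero_add]
    · simp
    · intro i hi
      exact if_neg (by simpa using hi)
  rw [h4]
  simp_rw [pow_add, mul_assoc]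
  rw [ENNReal.tsum_mul_right, ENNReal.tsum_geometric, ← mul_assoc, ENNReal.mul_inv_cancel h1 h2,
    one_mul]

lemma tsum_pow_mul_le (α : ℝ≥0) (hα : α < 1) {C : ℕ → ℝ≥0∞} {W B : ℝ≥0∞}
    (hC : ∀ N : ℕ, ∑ t ∈ Finset.range N, C t ≤ N * W + B) :
    ∑' t, (α : ℝ≥0∞) ^ t * C t ≤ (1 - (α : ℝ≥0∞))⁻¹ * W + B := by
  have h1 : (1 - (α : ℝ≥0∞)) ≠ 0 := (tsub_pos_of_lt (by exact_mod_cast hα)).ne'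
  have h2 : (1 - (α : ℝ≥0∞)) ≠ ⊤ := by finiteness
  have hW := tsum_pow_mul_eq α hα (fun _ => W)
  rw [ENNReal.tsum_mul_right, ENNReal.tsum_geometric] at hW
  rw [tsum_pow_mul_eq α hα, hW]
  calc _ ≤ (1 - (α : ℝ≥0∞)) * ∑' N, ((α : ℝ≥0∞) ^ N * ∑ t ∈ Finset.range (N + 1), W
          + (α : ℝ≥0∞) ^ N * B) := by
        gcongr with N
        rw [← mul_add]
        gcongr
        simpa using hC (N + 1)
    _ = _ := by
        rw [ENNReal.tsum_add, mul_add, ENNReal.tsum_mul_right, ENNReal.tsum_geometric,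
          ← mul_assoc (1 - (α : ℝ≥0∞)) _ B, ENNReal.mul_inv_cancel h1 h2, one_mul]

end Abel

section AverageCost

lemma sum_expShiftCost_le_of_inv_mul_vFin_lt {M : MDP X A} {L : ℝ≥0}
    (hL : ∀ x a, ((-L : ℝ) : EReal) ≤ M.c x a) (p : Policy X A) (x : X) {N : ℕ} (hN : 0 < N)
    {w : ℝ} (h : (((N : ℝ)⁻¹ : ℝ) : EReal) * vFin M N p x < w) :
    0 ≤ w + L ∧ ∑ t ∈ Finset.range N, expShiftCost M L p x t ≤ N * ENNReal.ofReal (w + L) := by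
  have hN' : (0 : ℝ) < N := by exact_mod_cast hN
  rw [vFin_eq hL] at h
  generalize (∑ t ∈ Finset.range N, expShiftCost M L p x t) = s at h ⊢
  induction s with
  | top =>
    rw [EReal.coe_ennreal_top, EReal.top_sub_coe,
      EReal.coe_mul_top_of_pos (inv_pos.2 hN')] at h
    exact absurd h (by simp)
  | coe s =>
    change (((N : ℝ)⁻¹ : ℝ) : EReal) * (((s : ℝ) : EReal) - ((N * L : ℝ) : EReal)) < w at h
    rw [← EReal.coe_sub, ← EReal.coe_mul, EReal.coe_lt_coe_iff, inv_mul_lt_iff₀ hN'] at h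
    have hs : (s : ℝ) ≤ N * (w + L) := by linarith
    have hw : 0 ≤ w + L := nonneg_of_mul_nonneg_right (s.2.trans hs) hN'
    refine ⟨hw, ?_⟩
    rw [← ENNReal.ofReal_natCast, ← ENNReal.ofReal_mul hN'.le, ← ENNReal.ofReal_coe_nnreal]
    exact ENNReal.ofReal_le_ofReal hs

lemma one_sub_mul_vDisc_le {M : MDP X A} {L : ℝ≥0} (hL : ∀ x a, ((-L : ℝ) : EReal) ≤ M.c x a)
    (p : Policy X A) (x : X) {w : ℝ} (hw : 0 ≤ w + L) {B : ℝ} (hB : 0 ≤ B)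
    (hS : ∀ N : ℕ, ∑ t ∈ Finset.range N, expShiftCost M L p x t
      ≤ N * ENNReal.ofReal (w + L) + ENNReal.ofReal B)
    {α : ℝ} (hα : α ∈ Set.Ico (0 : ℝ) 1) :
    ((1 - α : ℝ) : EReal) * vDisc M α p x ≤ ((w + (1 - α) * B : ℝ) : EReal) := by
  lift α to ℝ≥0 using hα.1
  have hα1 : α < 1 := by exact_mod_cast hα.2
  have h0 : (0 : ℝ) < 1 - α := sub_pos.2 hα.2
  have hT := tsum_pow_mul_le α hα1 hS
  have hE : (1 - (α : ℝ≥0∞))⁻¹ * ENNReal.ofReal (w + L) + ENNReal.ofReal B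
      = ENNReal.ofReal ((1 - α : ℝ)⁻¹ * (w + L) + B) := by
    rw [ENNReal.ofReal_add (by positivity) hB, ENNReal.ofReal_mul (by positivity),
      ENNReal.ofReal_inv_of_pos h0, ENNReal.ofReal_sub _ α.coe_nonneg, ENNReal.ofReal_one,
      ENNReal.ofReal_coe_nnreal]
  rw [hE] at hT
  have hT' := EReal.coe_ennreal_le_coe_ennreal_iff.2 hT
  rw [EReal.coe_ennreal_ofReal, max_eq_left (by positivity)] at hT'
  calc ((1 - α : ℝ) : EReal) * vDisc M α p x
      ≤ ((1 - α : ℝ) : EReal)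
        * ((((1 - α : ℝ)⁻¹ * (w + L) + B : ℝ) : EReal) - ((L / (1 - α) : ℝ) : EReal)) := by
        rw [vDisc_eq hL p x hα1]
        exact mul_le_mul_of_nonneg_left (EReal.sub_le_sub hT' le_rfl)
          (EReal.coe_nonneg.2 h0.le)
    _ = ((w + (1 - α) * B : ℝ) : EReal) := by
        rw [← EReal.coe_sub, ← EReal.coe_mul]
        congr 1
        field_simp
        ring

lemma exists_neg_le_cost (M : MDP X A) (w : ℝ) :
    ∃ L : ℝ≥0, (∀ x a, ((-L : ℝ) : EReal) ≤ M.c x a) ∧ 0 ≤ w + L := by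
  obtain ⟨K, hK⟩ := M.c_ne_bot
  refine ⟨⟨|K| + |w|, by positivity⟩, fun x a => le_trans ?_ (hK x a), ?_⟩
  · rw [EReal.coe_le_coe_iff]
    change -(|K| + |w|) ≤ K
    linarith [neg_abs_le K, abs_nonneg w]
  · change 0 ≤ w + (|K| + |w|)
    linarith [neg_abs_le w, abs_nonneg K]

/-- An Abelian theorem: normalized discounted costs are asymptotically at most the average cost. -/
lemma limsup_one_sub_mul_vDisc_le_avgCost (M : MDP X A) (p : Policy X A) (x : X) :
    Filter.limsup (fun α : ℝ => ((1 - α : ℝ) : EReal) * vDisc M α p x) (𝓝[Set.Ico (0 : ℝ) 1] 1)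
      ≤ avgCost M p x := by
  rw [← EReal.le_of_forall_lt_iff_le]
  intro w hw
  obtain ⟨L, hL, -⟩ := exists_neg_le_cost M 0
  obtain ⟨N₀, hN₀⟩ := eventually_atTop.1 (eventually_lt_of_limsup_lt hw)
  have hS : ∀ N ≥ N₀ + 1, 0 ≤ w + L ∧ ∑ t ∈ Finset.range N, expShiftCost M L p x t
      ≤ N * ENNReal.ofReal (w + L) := fun N hN =>
    sum_expShiftCost_le_of_inv_mul_vFin_lt hL p x (by omega) (hN₀ N (by omega))
  have hw0 : 0 ≤ w + L := (hS _ le_rfl).1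
  set B : ℝ := (N₀ + 1 : ℕ) * (w + L) with hBdef
  have hB : 0 ≤ B := by positivity
  have hS' : ∀ N : ℕ, ∑ t ∈ Finset.range N, expShiftCost M L p x t
      ≤ N * ENNReal.ofReal (w + L) + ENNReal.ofReal B := by
    intro N
    rcases le_total (N₀ + 1) N with h | h
    · exact (hS N h).2.trans le_self_add
    · refine le_trans (Finset.sum_le_sum_of_subset (Finset.range_mono h)) ?_
      rw [hBdef, ENNReal.ofReal_mul (by positivity), ENNReal.ofReal_natCast]
      exact (hS _ le_rfl).2.trans le_add_self
  have hlim : Tendsto (fun α : ℝ => ((w + (1 - α) * B : ℝ) : EReal))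
      (𝓝[Set.Ico (0 : ℝ) 1] 1) (𝓝 (w : EReal)) := by
    refine (continuous_coe_real_ereal.tendsto _).comp (tendsto_nhdsWithin_of_tendsto_nhds ?_)
    have h : Continuous fun α : ℝ => w + (1 - α) * B := by fun_prop
    simpa using h.tendsto 1
  have : (𝓝[Set.Ico (0 : ℝ) 1] 1).NeBot := right_nhdsWithin_Ico_neBot one_pos
  rw [← hlim.limsup_eq]
  refine limsup_le_limsup ?_
  filter_upwards [self_mem_nhdsWithin] with α hα
  exact one_sub_mul_vDisc_le hL p x hw0 hB hS' hα

variable (M : MDP X A) {φ : X → A} (hφ : Measurable φ)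

lemma sum_expShiftCost_detPolicy_add_le {L : ℝ≥0} {W : ℝ≥0∞} {f : X → ℝ≥0∞} (hf : Measurable f)
    (h : ∀ x, shiftCost M L (x, φ x) + ∫⁻ y, f y ∂M.q (x, φ x) ≤ W + f x) (x : X) (N : ℕ) :
    ∑ t ∈ Finset.range N, expShiftCost M L (detPolicy φ hφ) x t
      + ∫⁻ h, f h.2 ∂histMeas M (detPolicy φ hφ) x N ≤ N * W + f x := by
  induction N with
  | zero =>
    have hf' : Measurable fun h : Hist X A 0 => f h.2 := hf.comp measurable_snd
    simp [histMeas, lintegral_dirac' _ hf']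
  | succ N ih =>
    have hC : expShiftCost M L (detPolicy φ hφ) x N
        = ∫⁻ h, shiftCost M L (h.2, φ h.2) ∂histMeas M (detPolicy φ hφ) x N := by
      rw [expShiftCost, lintegral_saMeas _ _ _ _ (measurable_shiftCost M L)]
      refine lintegral_congr fun h => ?_
      rw [detPolicy, Kernel.lintegral_deterministic']
      exact (measurable_shiftCost M L).comp measurable_prodMk_left
    have hU : ∫⁻ h, f h.2 ∂histMeas M (detPolicy φ hφ) x (N + 1)
        = ∫⁻ h, ∫⁻ y, f y ∂M.q (h.2, φ h.2) ∂histMeas M (detPolicy φ hφ) x N := by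
      rw [lintegral_histMeas_succ _ _ _ _ hf]
      refine lintegral_congr fun h => ?_
      rw [detPolicy, Kernel.lintegral_deterministic']
      exact (hf.lintegral_kernel (κ := M.q)).comp measurable_prodMk_left
    have hc : Measurable fun h : Hist X A N => shiftCost M L (h.2, φ h.2) :=
      (measurable_shiftCost M L).comp (measurable_snd.prodMk (hφ.comp measurable_snd))
    have hW := lintegral_one_histMeas M (detPolicy φ hφ) x N
    rw [lintegral_const, one_mul] at hW
    have hstep : expShiftCost M L (detPolicy φ hφ) x N
        + ∫⁻ h, f h.2 ∂histMeas M (detPolicy φ hφ) x (N + 1)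
        ≤ W + ∫⁻ h, f h.2 ∂histMeas M (detPolicy φ hφ) x N := by
      rw [hC, hU, ← lintegral_add_left hc]
      refine (lintegral_mono fun h' : Hist X A N => h h'.2).trans_eq ?_
      rw [lintegral_add_left measurable_const, lintegral_const, hW, mul_one]
    rw [Finset.sum_range_succ, add_assoc]
    calc _ ≤ ∑ t ∈ Finset.range N, expShiftCost M L (detPolicy φ hφ) x t
          + (W + ∫⁻ h, f h.2 ∂histMeas M (detPolicy φ hφ) x N) := by gcongr
      _ = W + (∑ t ∈ Finset.range N, expShiftCost M L (detPolicy φ hφ) x t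
          + ∫⁻ h, f h.2 ∂histMeas M (detPolicy φ hφ) x N) := add_left_comm _ _ _
      _ ≤ W + (N * W + f x) := by gcongr
      _ = _ := by push_cast; ring

lemma avgCost_detPolicy_le {u : X → ℝ} (hu_nonneg : ∀ x, 0 ≤ u x) (hu_meas : Measurable u)
    {w : ℝ} (h : ∀ x, M.c x (φ x)
        + ((∫⁻ y, ENNReal.ofReal (u y) ∂(M.q (x, φ x)) : ℝ≥0∞) : EReal)
      ≤ (w : EReal) + (u x : EReal)) (x : X) :
    avgCost M (detPolicy φ hφ) x ≤ w := by
  obtain ⟨L, hL, hw⟩ := exists_neg_le_cost M w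
  have hshift : ∀ y, shiftCost M L (y, φ y) + ∫⁻ z, ENNReal.ofReal (u z) ∂M.q (y, φ y)
      ≤ ENNReal.ofReal (w + L) + ENNReal.ofReal (u y) := by
    intro y
    rw [← EReal.coe_ennreal_le_coe_ennreal_iff, EReal.coe_ennreal_add, EReal.coe_ennreal_add,
      coe_shiftCost hL, EReal.coe_ennreal_ofReal, EReal.coe_ennreal_ofReal, max_eq_left hw,
      max_eq_left (hu_nonneg y), EReal.coe_add, add_right_comm, add_right_comm (w : EReal)]
    exact add_le_add_left (h y) _
  have hlim : Tendsto (fun N : ℕ => ((w + (N : ℝ)⁻¹ * u x : ℝ) : EReal)) atTop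
      (𝓝 (w : EReal)) := by
    refine (continuous_coe_real_ereal.tendsto _).comp ?_
    simpa using tendsto_const_nhds.add
      ((tendsto_inv_atTop_nhds_zero_nat (𝕜 := ℝ)).mul_const (u x))
  rw [← hlim.limsup_eq]
  refine limsup_le_limsup ?_
  filter_upwards [eventually_gt_atTop 0] with N hN
  have hN' : (0 : ℝ) < N := by exact_mod_cast hN
  have hS := le_self_add.trans (sum_expShiftCost_detPolicy_add_le M hφ
    hu_meas.ennreal_ofReal hshift x N)
  rw [← ENNReal.ofReal_natCast, ← ENNReal.ofReal_mul hN'.le,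
    ← ENNReal.ofReal_add (by positivity) (hu_nonneg x),
    ← EReal.coe_ennreal_le_coe_ennreal_iff, EReal.coe_ennreal_ofReal,
    max_eq_left (by have := hu_nonneg x; positivity)] at hS
  rw [vFin_eq hL]
  refine (mul_le_mul_of_nonneg_left (EReal.sub_le_sub hS le_rfl)
    (EReal.coe_nonneg.2 (inv_nonneg.2 hN'.le))).trans_eq ?_
  rw [← EReal.coe_sub, ← EReal.coe_mul]
  congr 1
  field_simp
  ring

end AverageCost

section NormalizedLimits

variable (M : MDP X A)

lemma ne_bot_of_cost_add_le {x : X} {b : A} {i : ℝ≥0∞} {w : EReal} {r : ℝ}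
    (h : M.c x b + (i : EReal) ≤ w + (r : EReal)) : w ≠ ⊥ := by
  rintro rfl
  obtain ⟨K, hK⟩ := M.c_ne_bot
  rw [EReal.bot_add, le_bot_iff, EReal.add_eq_bot_iff] at h
  rcases h with h | h
  · exact absurd (hK x b) (by simp [h])
  · exact EReal.coe_ennreal_ne_bot _ h

lemma limsup_one_sub_mul_vDiscOpt_le_avgOpt (x : X) :
    Filter.limsup (fun α : ℝ => ((1 - α : ℝ) : EReal) * vDiscOpt M α x) (𝓝[Set.Ico (0 : ℝ) 1] 1)
      ≤ avgOpt M x := by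
  refine le_iInf fun p => le_trans (limsup_le_limsup ?_)
    (limsup_one_sub_mul_vDisc_le_avgCost M p x)
  filter_upwards [self_mem_nhdsWithin] with α hα
  exact mul_le_mul_of_nonneg_left (iInf_le _ p) (EReal.coe_nonneg.2 (sub_nonneg.2 hα.2.le))

lemma wBar_le_limsup_one_sub_mul_vDiscOpt (x : X) :
    wBar M ≤ Filter.limsup (fun α : ℝ => ((1 - α : ℝ) : EReal) * vDiscOpt M α x)
      (𝓝[Set.Ico (0 : ℝ) 1] 1) := by
  refine limsup_le_limsup ?_
  filter_upwards [self_mem_nhdsWithin] with α hα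
  exact mul_le_mul_of_nonneg_left (iInf_le _ x) (EReal.coe_nonneg.2 (sub_nonneg.2 hα.2.le))

lemma wBar_le_wStar : wBar M ≤ wStar M :=
  le_iInf fun x => (wBar_le_limsup_one_sub_mul_vDiscOpt M x).trans
    (limsup_one_sub_mul_vDiscOpt_le_avgOpt M x)

variable {a : ℕ → ℝ}

lemma limsup_seq_le_limsup_nhdsWithin (ha : ∀ n, a n ∈ Set.Ico (0 : ℝ) 1)
    (hatend : Tendsto a atTop (𝓝 1)) (f : ℝ → EReal) :
    Filter.limsup (fun n => f (a n)) atTop ≤ Filter.limsup f (𝓝[Set.Ico (0 : ℝ) 1] 1) := by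
  have h : Tendsto a atTop (𝓝[Set.Ico (0 : ℝ) 1] 1) :=
    tendsto_nhdsWithin_iff.2 ⟨hatend, Eventually.of_forall ha⟩
  exact limsup_le_limsup_of_le (f := Filter.map a atTop) h

lemma wBarSeq_le_wBar (ha : ∀ n, a n ∈ Set.Ico (0 : ℝ) 1) (hatend : Tendsto a atTop (𝓝 1)) :
    wBarSeq M a ≤ wBar M :=
  limsup_seq_le_limsup_nhdsWithin ha hatend fun α => ((1 - α : ℝ) : EReal) * mDisc M α

lemma wBarSeq_le_limsup_one_sub_mul_vDiscOpt (ha : ∀ n, a n ∈ Set.Ico (0 : ℝ) 1) (x : X) :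
    wBarSeq M a ≤ Filter.limsup (fun n => ((1 - a n : ℝ) : EReal) * vDiscOpt M (a n) x) atTop :=
  limsup_le_limsup (Eventually.of_forall fun n =>
    mul_le_mul_of_nonneg_left (iInf_le _ x) (EReal.coe_nonneg.2 (sub_nonneg.2 (ha n).2.le)))

end NormalizedLimits

section Statements

variable {X A : Type*} [MetricSpace X] [TopologicalSpace.SeparableSpace X]
  [MeasurableSpace X] [BorelSpace X] [StandardBorelSpace X]
  [MetricSpace A] [TopologicalSpace.SeparableSpace A]
  [MeasurableSpace A] [BorelSpace A] [StandardBorelSpace A]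

/-- Theorem 3.1. Under Assumption B(i), if a nonnegative measurable
`u : X → ℝ` and a deterministic policy `φ` satisfy
`c(x,φ(x)) + ∫ u dq(·|x,φ(x)) ≤ w̄_{{α_n}} + u(x)` for all `x`, then `φ` is average-cost
optimal, `w(x) = w^φ(x) = limsup_n (1-α_n) v_{α_n}(x) = limsup_{α↑1} (1-α) v_α(x)
= w̄ = w̄_{{α_n}} = w*` for all `x`, and `φ` with the same `u` satisfies the WACOI. -/
theorem statement0
    (M : MDP X A) (a : ℕ → ℝ)
    (ha : ∀ n, a n ∈ Set.Ico (0 : ℝ) 1) (hamono : Monotone a)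
    (hatend : Tendsto a atTop (𝓝 (1 : ℝ)))
    (hB1 : wStar M < ⊤)
    (u : X → ℝ) (hu_nonneg : ∀ x, 0 ≤ u x) (hu_meas : Measurable u)
    (φ : X → A) (hφ : Measurable φ)
    (hineq : ∀ x, M.c x (φ x)
        + ((∫⁻ y, ENNReal.ofReal (u y) ∂ (M.q (x, φ x)) : ℝ≥0∞) : EReal)
      ≤ wBarSeq M a + (u x : EReal)) :
    (∀ x, avgCost M (detPolicy φ hφ) x = avgOpt M x)
    ∧ (∀ x, avgOpt M x = wStar M
        ∧ avgCost M (detPolicy φ hφ) x = wStar M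
        ∧ Filter.limsup (fun n => ((1 - a n : ℝ) : EReal) * vDiscOpt M (a n) x) atTop = wStar M
        ∧ Filter.limsup (fun α : ℝ => ((1 - α : ℝ) : EReal) * vDiscOpt M α x)
            (𝓝[Set.Ico (0 : ℝ) 1] 1) = wStar M)
    ∧ wBar M = wStar M ∧ wBarSeq M a = wStar M
    ∧ (∀ x, M.c x (φ x)
        + ((∫⁻ y, ENNReal.ofReal (u y) ∂ (M.q (x, φ x)) : ℝ≥0∞) : EReal)
      ≤ wBar M + (u x : EReal)) := by
  have hle : wBarSeq M a ≤ wBar M := wBarSeq_le_wBar M ha hatend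
  have hst : wBar M ≤ wStar M := wBar_le_wStar M
  have hφw : ∀ x, avgCost M (detPolicy φ hφ) x ≤ wBarSeq M a := by
    intro x
    have htop : wBarSeq M a ≠ ⊤ := ((hle.trans hst).trans_lt hB1).ne
    have hbot : wBarSeq M a ≠ ⊥ := ne_bot_of_cost_add_le M (hineq x)
    have hcoe := EReal.coe_toReal htop hbot
    rw [← hcoe] at hineq ⊢
    exact avgCost_detPolicy_le M hφ hu_nonneg hu_meas hineq x
  have hne : Nonempty X := by
    by_contra h
    rw [not_nonempty_iff] at h
    simp [wStar] at hB1
  have hw : ∀ x, wStar M ≤ avgOpt M x := fun x => iInf_le _ x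
  have hopt : ∀ x, avgOpt M x ≤ avgCost M (detPolicy φ hφ) x := fun x => iInf_le _ _
  have hseq : wBarSeq M a = wStar M :=
    le_antisymm (hle.trans hst) (((hw hne.some).trans (hopt _)).trans (hφw _))
  have hbar : wBar M = wStar M := le_antisymm hst (hseq ▸ hle)
  have hφs : ∀ x, avgCost M (detPolicy φ hφ) x ≤ wStar M := fun x => hseq ▸ hφw x
  have havg : ∀ x, avgOpt M x = wStar M := fun x => le_antisymm ((hopt x).trans (hφs x)) (hw x)
  have hcost : ∀ x, avgCost M (detPolicy φ hφ) x = wStar M := fun x =>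
    le_antisymm (hφs x) ((hw x).trans (hopt x))
  have hdisc : ∀ x, Filter.limsup (fun α : ℝ => ((1 - α : ℝ) : EReal) * vDiscOpt M α x)
      (𝓝[Set.Ico (0 : ℝ) 1] 1) ≤ wStar M := fun x =>
    (limsup_one_sub_mul_vDiscOpt_le_avgOpt M x).trans_eq (havg x)
  refine ⟨fun x => (hcost x).trans (havg x).symm, fun x => ⟨havg x, hcost x, ?_, ?_⟩, hbar, hseq,
    fun x => by rw [hbar, ← hseq]; exact hineq x⟩
  · exact le_antisymm (le_trans (limsup_seq_le_limsup_nhdsWithin ha hatend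
        fun α => ((1 - α : ℝ) : EReal) * vDiscOpt M α x) (hdisc x))
      (hseq ▸ wBarSeq_le_limsup_one_sub_mul_vDiscOpt M ha x)
  · exact le_antisymm (hdisc x) (hbar ▸ wBar_le_limsup_one_sub_mul_vDiscOpt M x)

end Statements

end
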